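/- arXiv:2103.03847 — 2 statements merged into one kernel-verified Lean document; each statement's English description precedes it below -/
import Mathlib

section
/- Let κ > 0 and a ∈ ℝ \ {0}. Let q : ℝ → ℝ be continuous and suppose there are constants C, λ > 0 with dist(q(t), 2πℤ) ≤ C e^{−λ|t|} for all t ∈ ℝ. Suppose further that there exist t̄ ∈ ℝ, σ ∈ (0, π/(4|a|)) and a closed interval J with J ⊆ (0, 2π) (so J is bounded away from 2πℤ) such that the reduction of q(t) modulo 2π lies in J if and only if t ∈ [t̄ − σ, t̄ + σ]. Then there exists a 2π-periodic function f : ℝ → ℝ which extends to a bounded holomorphic function on the strip {z ∈ ℂ : |Im z| < κ} — in fact f may be chosen of the form x ↦ cos(kx) or x ↦ sin(kx) for some k ∈ ℤ — such that ∫_ℝ (f(q(t)) − f(0)) e^{iat} dt ≠ 0. -/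
open Real Set MeasureTheory

noncomputable section

/-- distance from a real number to the lattice `2πℤ` -/
def latDist (x : ℝ) : ℝ := Metric.infDist x (Set.range (fun m : ℤ => 2 * π * m))

theorem mel_integrable_exp (lam : ℝ) (hlam : 0 < lam) :
    Integrable (fun t : ℝ => Real.exp (-lam * |t|)) := by
  rw [← integrableOn_univ, ← Set.Iic_union_Ioi (a := (0:ℝ))]
  refine IntegrableOn.union ?_ ?_
  · refine (integrableOn_exp_mul_Iic hlam 0).congr_fun ?_ measurableSet_Iic
    intro t ht
    simp only [Set.mem_Iic] at ht
    simp [abs_of_nonpos ht]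
  · refine (exp_neg_integrableOn_Ioi 0 hlam).congr_fun ?_ measurableSet_Ioi
    intro t ht
    simp only [Set.mem_Ioi] at ht
    simp [abs_of_pos ht]

theorem mel_exp_bound (k : ℤ) (x : ℝ) :
    ‖Complex.exp (Complex.I * ((k * x : ℝ) : ℂ)) - 1‖ ≤ |(k : ℝ)| * latDist x := by
  by_cases hk : k = 0
  · simp [hk]
  have hk' : 0 < |(k : ℝ)| := abs_pos.mpr (by exact_mod_cast hk)
  rw [mul_comm |(k : ℝ)|, ← div_le_iff₀ hk', latDist, Metric.le_infDist (Set.range_nonempty _)]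
  rintro _ ⟨m, rfl⟩
  rw [div_le_iff₀ hk', Real.dist_eq]
  have h := @Real.norm_exp_I_mul_ofReal_sub_one_le (k * (x - 2 * π * m))
  have e : Complex.exp (Complex.I * ((k * (x - 2 * π * m) : ℝ) : ℂ))
      = Complex.exp (Complex.I * ((k * x : ℝ) : ℂ)) := by
    rw [Complex.exp_eq_exp_iff_exists_int]
    refine ⟨-(k * m), ?_⟩
    push_cast
    ring
  rw [e, Real.norm_eq_abs, abs_mul] at h
  linarith

theorem mel_fourier_indicator [Fact (0 < 2 * π)] (q : ℝ → ℝ) (hq : Continuous q) (W : ℝ → ℂ)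
    (hW : Integrable W)
    (h0 : ∀ n : ℤ, ∫ t, fourier n ((q t : ℝ) : AddCircle (2 * π)) * W t = 0)
    (K : Set (AddCircle (2 * π))) (hK : IsClosed K) :
    ∫ t, ({t | ((q t : ℝ) : AddCircle (2 * π)) ∈ K}).indicator W t = 0 := by
  have hqc : Continuous (fun t => ((q t : ℝ) : AddCircle (2 * π))) :=
    (AddCircle.continuous_mk' (2 * π)).comp hq
  have hint : ∀ h : C(AddCircle (2 * π), ℂ),
      Integrable (fun t => h ((q t : ℝ) : AddCircle (2 * π)) * W t) := by
    intro h
    refine hW.bdd_mul (c := ‖h‖) ?_ ?_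
    · exact (h.continuous.comp hqc).aestronglyMeasurable
    · exact Filter.Eventually.of_forall fun t => h.norm_coe_le_norm _
  let L0 : C(AddCircle (2 * π), ℂ) →ₗ[ℂ] ℂ :=
    { toFun := fun h => ∫ t, h ((q t : ℝ) : AddCircle (2 * π)) * W t
      map_add' := by
        intro f g
        rw [← integral_add (hint f) (hint g)]
        congr 1
        ext t
        simp [add_mul]
      map_smul' := by
        intro c f
        simp only [RingHom.id_apply, smul_eq_mul]
        rw [← integral_const_mul]
        congr 1
        ext t
        simp [mul_assoc] }
  let L : C(AddCircle (2 * π), ℂ) →L[ℂ] ℂ := L0.mkContinuous (∫ t, ‖W t‖) (by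
    intro h
    change ‖∫ t, h ((q t : ℝ) : AddCircle (2 * π)) * W t‖ ≤ _
    rw [← integral_mul_const]
    refine norm_integral_le_of_norm_le (hW.norm.mul_const _) ?_
    refine Filter.Eventually.of_forall fun t => ?_
    rw [norm_mul, mul_comm]
    exact mul_le_mul_of_nonneg_left (h.norm_coe_le_norm _) (norm_nonneg _))
  have hL : ∀ h : C(AddCircle (2 * π), ℂ),
      ∫ t, h ((q t : ℝ) : AddCircle (2 * π)) * W t = 0 := by
    intro h
    have h1 : (Submodule.span ℂ (Set.range (@fourier (2 * π)))).topologicalClosure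
        ≤ L.toLinearMap.ker := by
      refine Submodule.topologicalClosure_minimal _ ?_ L.isClosed_ker
      rw [Submodule.span_le]
      rintro _ ⟨n, rfl⟩
      exact h0 n
    rw [span_fourier_closure_eq_top] at h1
    exact h1 (Submodule.mem_top (x := h))
  let δ : ℕ → ℝ := fun n => 1 / ((n : ℝ) + 1)
  have hδ : ∀ n, 0 < δ n := fun n => Nat.one_div_pos_of_nat
  have hlim := thickenedIndicator_tendsto_indicator_closure hδ
    tendsto_one_div_add_atTop_nhds_zero_nat K
  rw [hK.closure_eq, tendsto_pi_nhds] at hlim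
  let H : ℕ → C(AddCircle (2 * π), ℂ) := fun n =>
    ⟨fun x => (((thickenedIndicator (hδ n) K x : NNReal) : ℝ) : ℂ), by fun_prop⟩
  have hT : Filter.Tendsto (fun n => ∫ t, H n ((q t : ℝ) : AddCircle (2 * π)) * W t) Filter.atTop
      (nhds (∫ t, ({t | ((q t : ℝ) : AddCircle (2 * π)) ∈ K}).indicator W t)) := by
    refine tendsto_integral_of_dominated_convergence (fun t => ‖W t‖)
      (fun n => (hint (H n)).aestronglyMeasurable) hW.norm ?_ ?_
    · intro n
      refine Filter.Eventually.of_forall fun t => ?_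
      rw [norm_mul]
      refine mul_le_of_le_one_left (norm_nonneg _) ?_
      have := thickenedIndicator_le_one (hδ n) K ((q t : ℝ) : AddCircle (2 * π))
      simp only [H, ContinuousMap.coe_mk, Complex.norm_real, Real.norm_eq_abs, NNReal.abs_eq]
      exact_mod_cast this
    · refine Filter.Eventually.of_forall fun t => ?_
      have h2 := hlim ((q t : ℝ) : AddCircle (2 * π))
      have h3 : Filter.Tendsto (fun n => H n ((q t : ℝ) : AddCircle (2 * π))) Filter.atTop
          (nhds (((K.indicator (fun _ => (1 : NNReal)) ((q t : ℝ) : AddCircle (2 * π)) : NNReal)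
            : ℝ) : ℂ)) :=
        (Complex.continuous_ofReal.tendsto _).comp ((NNReal.continuous_coe.tendsto _).comp h2)
      have h4 := h3.mul_const (W t)
      convert h4 using 2
      by_cases hm : ((q t : ℝ) : AddCircle (2 * π)) ∈ K
      · simp [hm]
      · simp [hm]
  simp only [hL] at hT
  exact (tendsto_nhds_unique hT tendsto_const_nhds)

theorem mel_norm_exp (κ : ℝ) (k : ℤ) (z : ℂ) (hz : |z.im| < κ) (s : ℝ) (hs : |s| = 1) :
    ‖Complex.exp (s * (k * z) * Complex.I)‖ ≤ Real.exp (|(k : ℝ)| * κ) := by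
  rw [Complex.norm_exp]
  apply Real.exp_le_exp.mpr
  have : ((s : ℂ) * (k * z) * Complex.I).re = -(s * (k * z.im)) := by simp
  rw [this]
  refine (neg_le_abs _).trans ?_
  rw [abs_mul, hs, one_mul, abs_mul]
  exact mul_le_mul_of_nonneg_left hz.le (abs_nonneg _)

theorem mel_cos_ext (κ : ℝ) (k : ℤ) :
    ∃ F : ℂ → ℂ, DifferentiableOn ℂ F {z : ℂ | |z.im| < κ} ∧
        (∃ Cb : ℝ, ∀ z ∈ {z : ℂ | |z.im| < κ}, ‖F z‖ ≤ Cb) ∧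
        (∀ x : ℝ, F (x : ℂ) = ((Real.cos (k * x) : ℝ) : ℂ)) := by
  refine ⟨fun z => Complex.cos (k * z), ?_, ⟨Real.exp (|(k : ℝ)| * κ), ?_⟩, ?_⟩
  · fun_prop
  · intro z hz
    have h1 := mel_norm_exp κ k z hz 1 (by simp)
    have h2 := mel_norm_exp κ k z hz (-1) (by simp)
    push_cast at h1 h2
    simp only [one_mul, neg_mul] at h1 h2
    simp only [Complex.cos, neg_mul]
    rw [norm_div, Complex.norm_ofNat]
    have := norm_add_le (Complex.exp (k * z * Complex.I)) (Complex.exp (-(k * z * Complex.I)))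
    linarith
  · intro x
    simp

theorem mel_sin_ext (κ : ℝ) (k : ℤ) :
    ∃ F : ℂ → ℂ, DifferentiableOn ℂ F {z : ℂ | |z.im| < κ} ∧
        (∃ Cb : ℝ, ∀ z ∈ {z : ℂ | |z.im| < κ}, ‖F z‖ ≤ Cb) ∧
        (∀ x : ℝ, F (x : ℂ) = ((Real.sin (k * x) : ℝ) : ℂ)) := by
  refine ⟨fun z => Complex.sin (k * z), ?_, ⟨Real.exp (|(k : ℝ)| * κ), ?_⟩, ?_⟩
  · fun_prop
  · intro z hz
    have h1 := mel_norm_exp κ k z hz 1 (by simp)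
    have h2 := mel_norm_exp κ k z hz (-1) (by simp)
    push_cast at h1 h2
    simp only [one_mul, neg_mul] at h1 h2
    simp only [Complex.sin, neg_mul]
    rw [norm_div, norm_mul, Complex.norm_I, mul_one, Complex.norm_ofNat]
    have := norm_sub_le (Complex.exp (-(k * z * Complex.I))) (Complex.exp (k * z * Complex.I))
    linarith
  · intro x
    simp

theorem exists_trig_monomial_melnikov_ne_zero
    (κ : ℝ) (hκ : 0 < κ) (a : ℝ) (ha : a ≠ 0)
    (q : ℝ → ℝ) (hq : Continuous q)
    (C lam : ℝ) (hC : 0 < C) (hlam : 0 < lam)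
    (hdecay : ∀ t, latDist (q t) ≤ C * Real.exp (-lam * |t|))
    (tbar σ c₁ c₂ : ℝ) (hσ : σ ∈ Set.Ioo 0 (π / (4 * |a|)))
    (hc₁ : 0 < c₁) (hc₁₂ : c₁ ≤ c₂) (hc₂ : c₂ < 2 * π)
    (hJ : ∀ t, (∃ m : ℤ, q t - 2 * π * m ∈ Set.Icc c₁ c₂) ↔ t ∈ Set.Icc (tbar - σ) (tbar + σ)) :
    ∃ f : ℝ → ℝ,
      ((∃ k : ℤ, f = fun x => Real.cos (k * x)) ∨ (∃ k : ℤ, f = fun x => Real.sin (k * x))) ∧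
      Function.Periodic f (2 * π) ∧
      (∃ F : ℂ → ℂ, DifferentiableOn ℂ F {z : ℂ | |z.im| < κ} ∧
        (∃ Cb : ℝ, ∀ z ∈ {z : ℂ | |z.im| < κ}, ‖F z‖ ≤ Cb) ∧
        (∀ x : ℝ, F (x : ℂ) = (f x : ℂ))) ∧
      (∫ t : ℝ, ((f (q t) - f 0 : ℝ) : ℂ) * Complex.exp (Complex.I * (a * t))) ≠ 0 := by
  by_contra hcon
  have hcos : ∀ k : ℤ, ∫ t : ℝ, ((Real.cos (k * q t) - 1 : ℝ) : ℂ) *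
      Complex.exp (Complex.I * (a * t)) = 0 := by
    intro k
    by_contra hne
    refine hcon ⟨fun x => Real.cos (k * x), Or.inl ⟨k, rfl⟩, ?_, mel_cos_ext κ k, ?_⟩
    · intro x
      simp only
      rw [mul_add]
      exact Real.cos_add_int_mul_two_pi _ k
    · simpa using hne
  have hsin : ∀ k : ℤ, ∫ t : ℝ, ((Real.sin (k * q t) : ℝ) : ℂ) *
      Complex.exp (Complex.I * (a * t)) = 0 := by
    intro k
    by_contra hne
    refine hcon ⟨fun x => Real.sin (k * x), Or.inr ⟨k, rfl⟩, ?_, mel_sin_ext κ k, ?_⟩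
    · intro x
      simp only
      rw [mul_add]
      exact Real.sin_add_int_mul_two_pi _ k
    · simpa using hne
  clear hcon
  have hE1 : ∀ t : ℝ, ‖Complex.exp (Complex.I * (a * t))‖ = 1 := by
    intro t
    rw [Complex.norm_exp]; simp
  have hEint : ∀ g : ℝ → ℂ, Integrable g →
      Integrable (fun t : ℝ => g t * Complex.exp (Complex.I * (a * t))) := by
    intro g hg
    refine hg.mul_bdd (c := 1) ?_ ?_
    · exact Continuous.aestronglyMeasurable (by fun_prop)
    · exact Filter.Eventually.of_forall fun t => (hE1 t).le
  have hei : ∀ k : ℤ, Integrable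
      (fun t : ℝ => Complex.exp (Complex.I * ((k * q t : ℝ) : ℂ)) - 1) := by
    intro k
    refine Integrable.mono' (((mel_integrable_exp lam hlam).const_mul C).const_mul |(k : ℝ)|) ?_ ?_
    · exact Continuous.aestronglyMeasurable (by fun_prop)
    · refine Filter.Eventually.of_forall fun t => ?_
      exact (mel_exp_bound k (q t)).trans
        (mul_le_mul_of_nonneg_left (hdecay t) (abs_nonneg _))
  have hre : ∀ (k : ℤ) (t : ℝ), Complex.exp (Complex.I * ((k * q t : ℝ) : ℂ)) - 1 =
      ((Real.cos (k * q t) - 1 : ℝ) : ℂ) + Complex.I * ((Real.sin (k * q t) : ℝ) : ℂ) := by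
    intro k t
    rw [mul_comm Complex.I, Complex.exp_mul_I]
    push_cast
    ring
  have hci : ∀ k : ℤ, Integrable (fun t : ℝ => ((Real.cos (k * q t) - 1 : ℝ) : ℂ)) := by
    intro k
    refine ((hei k).re).ofReal.congr (Filter.Eventually.of_forall fun t => ?_)
    simp only [hre, RCLike.re_to_complex, Complex.add_re, Complex.ofReal_re, Complex.I_mul_re,
      Complex.ofReal_im, neg_zero, add_zero]
    rfl
  have hsi : ∀ k : ℤ, Integrable (fun t : ℝ => ((Real.sin (k * q t) : ℝ) : ℂ)) := by
    intro k
    refine ((hei k).im).ofReal.congr (Filter.Eventually.of_forall fun t => ?_)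
    simp only [hre, RCLike.im_to_complex, Complex.add_im, Complex.ofReal_im, Complex.I_mul_im,
      Complex.ofReal_re, zero_add]
    rfl
  have hexp0 : ∀ k : ℤ, ∫ t : ℝ, (Complex.exp (Complex.I * ((k * q t : ℝ) : ℂ)) - 1) *
      Complex.exp (Complex.I * (a * t)) = 0 := by
    intro k
    have : ∀ t : ℝ, (Complex.exp (Complex.I * ((k * q t : ℝ) : ℂ)) - 1) *
        Complex.exp (Complex.I * (a * t)) =
        ((Real.cos (k * q t) - 1 : ℝ) : ℂ) * Complex.exp (Complex.I * (a * t)) +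
        Complex.I * (((Real.sin (k * q t) : ℝ) : ℂ) * Complex.exp (Complex.I * (a * t))) := by
      intro t
      rw [hre]; ring
    simp only [this]
    rw [integral_add (hEint _ (hci k)) ((hEint _ (hsi k)).const_mul _), integral_const_mul,
      hcos, hsin]
    simp
  have hwi : Integrable (fun t : ℝ => ((1 - Real.cos (q t) : ℝ) : ℂ)) := by
    refine (hci 1).neg.congr (Filter.Eventually.of_forall fun t => ?_)
    simp
  haveI : Fact (0 < 2 * π) := ⟨Real.two_pi_pos⟩
  have key := mel_fourier_indicator q hq
    (fun t : ℝ => ((1 - Real.cos (q t) : ℝ) : ℂ) * Complex.exp (Complex.I * (a * t)))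
    (hEint _ hwi) (by
      intro n
      have : ∀ t : ℝ, fourier n ((q t : ℝ) : AddCircle (2 * π)) *
          (((1 - Real.cos (q t) : ℝ) : ℂ) * Complex.exp (Complex.I * (a * t))) =
          (Complex.exp (Complex.I * ((n * q t : ℝ) : ℂ)) - 1) * Complex.exp (Complex.I * (a * t))
          - (1 / 2 : ℂ) * ((Complex.exp (Complex.I * (((n + 1 : ℤ) * q t : ℝ) : ℂ)) - 1) *
            Complex.exp (Complex.I * (a * t)))
          - (1 / 2 : ℂ) * ((Complex.exp (Complex.I * (((n - 1 : ℤ) * q t : ℝ) : ℂ)) - 1) *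
            Complex.exp (Complex.I * (a * t))) := by
        intro t
        have e0 : fourier n ((q t : ℝ) : AddCircle (2 * π)) =
            Complex.exp (Complex.I * ((n * q t : ℝ) : ℂ)) := by
          rw [fourier_coe_apply]
          congr 1
          have : (π : ℂ) ≠ 0 := by exact_mod_cast Real.pi_ne_zero
          push_cast
          field_simp
        have e1 : Complex.exp (Complex.I * (((n + 1 : ℤ) * q t : ℝ) : ℂ)) =
            Complex.exp (Complex.I * ((n * q t : ℝ) : ℂ)) * Complex.exp (q t * Complex.I) := by
          rw [← Complex.exp_add]
          congr 1
          push_cast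
          ring
        have e2 : Complex.exp (Complex.I * (((n - 1 : ℤ) * q t : ℝ) : ℂ)) =
            Complex.exp (Complex.I * ((n * q t : ℝ) : ℂ)) * Complex.exp (-q t * Complex.I) := by
          rw [← Complex.exp_add]
          congr 1
          push_cast
          ring
        rw [e0, e1, e2, Complex.ofReal_sub, Complex.ofReal_cos, Complex.cos, Complex.ofReal_one]
        ring
      simp only [this]
      have i0 := hEint _ (hei n)
      have i1 := (hEint _ (hei (n + 1))).const_mul (1 / 2 : ℂ)
      have i2 := (hEint _ (hei (n - 1))).const_mul (1 / 2 : ℂ)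
      rw [integral_sub (by exact i0.sub i1) i2, integral_sub i0 i1, integral_const_mul,
        integral_const_mul, hexp0, hexp0, hexp0]
      simp)
    (Set.image (fun x : ℝ => (x : AddCircle (2 * π))) (Set.Icc c₁ c₂))
    ((isCompact_Icc.image (AddCircle.continuous_mk' (2 * π))).isClosed)
  have hset : {t | ((q t : ℝ) : AddCircle (2 * π)) ∈
      Set.image (fun x : ℝ => (x : AddCircle (2 * π))) (Set.Icc c₁ c₂)} =
      Set.Icc (tbar - σ) (tbar + σ) := by
    ext t
    rw [← hJ t]
    simp only [Set.mem_setOf_eq, Set.mem_image]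
    constructor
    · rintro ⟨x, hx, hxe⟩
      rw [QuotientAddGroup.eq_iff_sub_mem, AddSubgroup.mem_zmultiples_iff] at hxe
      obtain ⟨m, hm⟩ := hxe
      refine ⟨-m, ?_⟩
      have : q t - 2 * π * ((-m : ℤ) : ℝ) = x := by
        rw [zsmul_eq_mul] at hm
        push_cast
        linarith
      rwa [this]
    · rintro ⟨m, hm⟩
      refine ⟨_, hm, ?_⟩
      rw [QuotientAddGroup.eq_iff_sub_mem, AddSubgroup.mem_zmultiples_iff]
      refine ⟨-m, ?_⟩
      rw [zsmul_eq_mul]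
      push_cast
      ring
  rw [hset, integral_indicator measurableSet_Icc] at key
  obtain ⟨hσ0, hσ1⟩ := hσ
  have hle : tbar - σ < tbar + σ := by linarith
  have hpos : 0 < ∫ t in (tbar - σ)..(tbar + σ),
      (1 - Real.cos (q t)) * Real.cos (a * (t - tbar)) := by
    refine intervalIntegral.intervalIntegral_pos_of_pos_on ?_ ?_ hle
    · exact Continuous.intervalIntegrable (by fun_prop) _ _
    · intro t ht
      refine mul_pos ?_ ?_
      · obtain ⟨m, hm1, hm2⟩ := (hJ t).mpr ⟨ht.1.le, ht.2.le⟩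
        have hlt : Real.cos (q t) ≠ 1 := by
          rw [Ne, Real.cos_eq_one_iff]
          rintro ⟨n, hn⟩
          have h1 : (0 : ℝ) < ((n - m : ℤ) : ℝ) := by
            push_cast
            by_contra hc
            push Not at hc
            nlinarith [Real.pi_pos]
          have h2 : ((n - m : ℤ) : ℝ) < 1 := by
            push_cast
            by_contra hc
            push Not at hc
            nlinarith [Real.pi_pos]
          have h1' : 0 < n - m := by exact_mod_cast h1
          have h2' : n - m < 1 := by exact_mod_cast h2
          omega
        have := lt_of_le_of_ne (Real.cos_le_one (q t)) hlt
        linarith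
      · have ha' : 0 < |a| := abs_pos.mpr ha
        have h1 : |t - tbar| ≤ σ := by
          rw [abs_le]; constructor <;> linarith [ht.1, ht.2]
        have h2 : |a * (t - tbar)| < π / 2 := by
          rw [abs_mul]
          have h3 : σ * (4 * |a|) < π := (lt_div_iff₀ (by positivity)).mp hσ1
          have h4 : |a| * |t - tbar| ≤ |a| * σ := mul_le_mul_of_nonneg_left h1 ha'.le
          nlinarith [Real.pi_pos]
        rw [abs_lt] at h2
        exact Real.cos_pos_of_mem_Ioo ⟨by linarith [h2.1], h2.2⟩
  have hzero : ∫ t in Set.Icc (tbar - σ) (tbar + σ),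
      Complex.exp (-(Complex.I * (a * tbar))) *
      (((1 - Real.cos (q t) : ℝ) : ℂ) * Complex.exp (Complex.I * (a * t))) = 0 := by
    rw [integral_const_mul, key, mul_zero]
  have hre0 := congrArg Complex.re hzero
  have hI : Integrable (fun t : ℝ => Complex.exp (-(Complex.I * (a * tbar))) *
      (((1 - Real.cos (q t) : ℝ) : ℂ) * Complex.exp (Complex.I * (a * t))))
      (volume.restrict (Set.Icc (tbar - σ) (tbar + σ))) :=
    ((hEint _ hwi).const_mul _).integrableOn
  have hcomm := integral_re hI
  simp only [RCLike.re_to_complex] at hcomm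
  rw [← hcomm] at hre0
  have hpt : ∀ t : ℝ, (Complex.exp (-(Complex.I * (a * tbar))) *
      (((1 - Real.cos (q t) : ℝ) : ℂ) * Complex.exp (Complex.I * (a * t)))).re =
      (1 - Real.cos (q t)) * Real.cos (a * (t - tbar)) := by
    intro t
    have : Complex.exp (-(Complex.I * (a * tbar))) *
      (((1 - Real.cos (q t) : ℝ) : ℂ) * Complex.exp (Complex.I * (a * t))) =
      ((1 - Real.cos (q t) : ℝ) : ℂ) * Complex.exp ((a * (t - tbar) : ℝ) * Complex.I) := by
      rw [mul_left_comm, ← Complex.exp_add]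
      congr 2
      push_cast
      ring
    rw [this, Complex.re_ofReal_mul, Complex.exp_ofReal_mul_I_re]
  simp only [hpt] at hre0
  rw [intervalIntegral.integral_of_le hle.le, ← integral_Icc_eq_integral_Ioc, hre0] at hpos
  simp at hpos
end
end

section
/- Assume additionally that each p⁰ᵢ, q⁰ᵢ is C¹ with |(p⁰ᵢ)'(t)| + |(q⁰ᵢ)'(t)| ≤ C e^{−λ|t|}, and that H₁ is C² with all second-order partial derivatives with respect to the (p,q) variables uniformly bounded (over q, φ, s arbitrary and p in the fixed compact convex set). Then for every point (I, φ, s) ∈ ℝᵈ × ℝᵈ × ℝ the Melnikov potential satisfies inf_{τ ∈ ℝⁿ} Σᵢ |∂L/∂τᵢ(τ, I, φ, s)| = 0. -/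
open Real Set MeasureTheory

noncomputable section

/-- the real phase space `ℝⁿ × ℝⁿ × ℝᵈ × ℝᵈ × ℝ` -/
abbrev RPt (n d : ℕ) :=
  (Fin n → ℝ) × (Fin n → ℝ) × (Fin d → ℝ) × (Fin d → ℝ) × ℝ

/-- partial derivative in the `i`-th coordinate -/
def pd {k : ℕ} (f : (Fin k → ℝ) → ℝ) (i : Fin k) (x : Fin k → ℝ) : ℝ :=
  deriv (fun s => f (Function.update x i s)) (x i)

/-- the integrand of the Melnikov potential -/
def melInt {n d : ℕ} (H₁ : RPt n d → ℝ) (ω : (Fin d → ℝ) → Fin d → ℝ)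
    (p0 q0 : Fin n → ℝ → ℝ) (τ : Fin n → ℝ) (I φv : Fin d → ℝ) (s t : ℝ) : ℝ :=
  H₁ (fun i => p0 i (τ i + t), fun i => q0 i (τ i + t), I,
        fun j => φv j + ω I j * t, s + t)
    - H₁ (0, 0, I, fun j => φv j + ω I j * t, s + t)

/-- the Melnikov potential -/
def Lmel {n d : ℕ} (H₁ : RPt n d → ℝ) (ω : (Fin d → ℝ) → Fin d → ℝ)
    (p0 q0 : Fin n → ℝ → ℝ) (τ : Fin n → ℝ) (I φv : Fin d → ℝ) (s : ℝ) : ℝ :=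
  - ∫ t : ℝ, melInt H₁ ω p0 q0 τ I φv s t

/-- A function invariant under coordinatewise shifts by `2π` is invariant under `2πℤᵏ`. -/
lemma periodic_lattice {k : ℕ} (f : (Fin k → ℝ) → ℝ)
    (hf : ∀ x i, f (Function.update x i (x i + 2 * π)) = f x) (m : Fin k → ℤ)
    (x : Fin k → ℝ) : f (fun i => x i - 2 * π * m i) = f x := by
  have h1 : ∀ i, Function.Periodic f (Pi.single i (2 * π)) := by
    intro i x
    rw [← hf x i]
    congr 1
    ext j
    by_cases h : j = i
    · subst h; simp
    · simp [h]
  have h2 : ∀ s : Finset (Fin k),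
      Function.Periodic f (∑ i ∈ s, m i • (Pi.single i (2 * π) : Fin k → ℝ)) := by
    intro s
    induction s using Finset.induction_on with
    | empty => intro x; simp
    | insert a s ha ih =>
      rw [Finset.sum_insert ha]
      exact ((h1 a).zsmul (m a)).add_period ih
  rw [← (h2 Finset.univ).sub_eq x]
  congr 1
  ext j
  simp [Finset.sum_apply, Pi.single_apply, mul_comm]

lemma integrable_expabs {lam : ℝ} (hlam : 0 < lam) :
    Integrable (fun t : ℝ => Real.exp (-lam * |t|)) := by
  rw [← integrableOn_univ, ← Set.Iic_union_Ioi (a := (0 : ℝ))]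
  refine IntegrableOn.union ?_ ?_
  · refine (integrableOn_exp_mul_Iic hlam 0).congr_fun ?_ measurableSet_Iic
    intro t ht
    have : |t| = -t := abs_of_nonpos ht
    simp [this]
  · refine (integrableOn_exp_mul_Ioi (neg_lt_zero.mpr hlam) 0).congr_fun ?_ measurableSet_Ioi
    intro t ht
    have : |t| = t := abs_of_pos ht
    simp [this]

/-- A bounded continuous function on `ℝⁿ` has points with arbitrarily small gradient. -/
lemma iInf_grad_eq_zero {n : ℕ} (F : (Fin n → ℝ) → ℝ) (hF : Continuous F) (B : ℝ)
    (hB : ∀ x, |F x| ≤ B) : (⨅ τ : Fin n → ℝ, ∑ i, |pd F i τ|) = 0 := by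
  have hB0 : 0 ≤ B := (abs_nonneg _).trans (hB 0)
  have key : ∀ ε : ℝ, 0 < ε → ∃ τ : Fin n → ℝ, ∀ i, |pd F i τ| ≤ ε := by
    intro ε hε
    set δ : ℝ := ε ^ 2 / (8 * B + 8) with hδ
    have hδ0 : 0 < δ := by positivity
    have hδe : 8 * B * δ ≤ ε ^ 2 := by
      rw [hδ, mul_div_assoc', div_le_iff₀ (by positivity)]
      nlinarith [sq_nonneg ε]
    set G : (Fin n → ℝ) → ℝ := fun x => F x + δ * ∑ i, x i ^ 2 with hG
    have hGc : Continuous G := by fun_prop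
    have hev : ∀ᶠ x in Filter.cocompact (Fin n → ℝ), G 0 ≤ G x := by
      have hc : IsCompact (Metric.closedBall (0 : Fin n → ℝ) (2 * B / δ + 1)) :=
        isCompact_closedBall _ _
      filter_upwards [hc.compl_mem_cocompact] with x hx
      by_contra hlt
      apply hx
      rw [mem_closedBall_zero_iff, pi_norm_le_iff_of_nonneg (by positivity)]
      intro i
      have h1 : x i ^ 2 ≤ ∑ i, x i ^ 2 :=
        Finset.single_le_sum (f := fun i => x i ^ 2) (fun i _ => sq_nonneg _) (Finset.mem_univ i)
      have h2 : δ * ∑ i, x i ^ 2 ≤ 2 * B := by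
        simp only [hG, not_le] at hlt
        have := abs_le.1 (hB x)
        have := abs_le.1 (hB 0)
        simp at hlt
        linarith
      have h3 : x i ^ 2 ≤ 2 * B / δ := by
        rw [le_div_iff₀ hδ0]
        nlinarith
      have h4 : 0 ≤ 2 * B / δ := by positivity
      rw [Real.norm_eq_abs]
      apply abs_le_of_sq_le_sq _ (by positivity)
      nlinarith
    obtain ⟨τ, hτ⟩ := hGc.exists_forall_le' 0 hev
    refine ⟨τ, fun i => ?_⟩
    have h1 : τ i ^ 2 ≤ ∑ i, τ i ^ 2 :=
      Finset.single_le_sum (f := fun i => τ i ^ 2) (fun i _ => sq_nonneg _) (Finset.mem_univ i)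
    have h2 : δ * ∑ i, τ i ^ 2 ≤ 2 * B := by
      have h := hτ 0
      have := abs_le.1 (hB τ)
      have := abs_le.1 (hB 0)
      simp [hG] at h
      linarith
    have h3 : δ * τ i ^ 2 ≤ 2 * B := (mul_le_mul_of_nonneg_left h1 hδ0.le).trans h2
    by_cases hd : DifferentiableAt ℝ (fun s => F (Function.update τ i s)) (τ i)
    · have e1 : ∀ s, G (Function.update τ i s)
          = F (Function.update τ i s) + δ * (s ^ 2 + ∑ j ∈ Finset.univ.erase i, τ j ^ 2) := by
        intro s
        simp only [hG]
        rw [← Finset.add_sum_erase _ _ (Finset.mem_univ i)]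
        congr 3
        · simp
        · apply Finset.sum_congr rfl
          intro j hj
          simp [Finset.ne_of_mem_erase hj]
      have e2 : HasDerivAt (fun s => G (Function.update τ i s)) (pd F i τ + δ * (2 * τ i)) (τ i) := by
        have a1 := hd.hasDerivAt
        have a2 : HasDerivAt (fun s : ℝ => δ * (s ^ 2 + ∑ j ∈ Finset.univ.erase i, τ j ^ 2))
            (δ * (2 * τ i)) (τ i) := by
          simpa using ((hasDerivAt_pow 2 (τ i)).add_const _).const_mul δ
        have a3 := a1.add a2
        exact a3.congr_of_eventuallyEq (Filter.Eventually.of_forall e1)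
      have e3 : IsLocalMin (fun s => G (Function.update τ i s)) (τ i) := by
        apply Filter.Eventually.of_forall
        intro s
        simpa using hτ _
      have e4 := e3.hasDerivAt_eq_zero e2
      have e5 : pd F i τ = -(2 * δ * τ i) := by linarith
      rw [e5]
      apply abs_le_of_sq_le_sq _ hε.le
      nlinarith
    · have : pd F i τ = 0 := deriv_zero_of_not_differentiableAt hd
      simp [this, hε.le]
  apply le_antisymm
  · apply le_of_forall_pos_le_add
    intro ε hε
    obtain ⟨τ, hτ⟩ := key (ε / (n + 1)) (by positivity)
    have hbdd : BddBelow (Set.range fun τ : Fin n → ℝ => ∑ i, |pd F i τ|) :=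
      ⟨0, by rintro _ ⟨x, rfl⟩; positivity⟩
    refine (ciInf_le hbdd τ).trans ?_
    refine (Finset.sum_le_sum fun i _ => hτ i).trans ?_
    simp only [Finset.sum_const, Finset.card_univ, Fintype.card_fin, nsmul_eq_mul, zero_add]
    rw [mul_div_assoc', div_le_iff₀ (by positivity)]
    nlinarith
  · exact Real.iInf_nonneg fun τ => by positivity

lemma lattice_approx {x r : ℝ} (h : latDist x < r) : ∃ m : ℤ, |x - 2 * π * m| < r := by
  unfold latDist at h
  rw [Metric.infDist_lt_iff (Set.range_nonempty _)] at h
  obtain ⟨_, ⟨m, rfl⟩, hm⟩ := h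
  exact ⟨m, hm⟩

lemma lattice_reduce (x : ℝ) : ∃ m : ℤ, |x - 2 * π * m| ≤ 2 * π := by
  have h := toIcoMod_mem_Ico' (two_pi_pos) x
  refine ⟨toIcoDiv two_pi_pos 0 x, ?_⟩
  have e : x - 2 * π * (toIcoDiv two_pi_pos 0 x : ℤ) = toIcoMod two_pi_pos 0 x := by
    rw [← self_sub_toIcoDiv_zsmul]; simp [mul_comm]
  rw [e, abs_of_nonneg h.1]
  exact h.2.le

theorem melnikov_inf_gradient_eq_zero
    {n d : ℕ} (hn : 1 ≤ n) (hd : 1 ≤ d)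
    (p0 q0 : Fin n → ℝ → ℝ) (p0' q0' : Fin n → ℝ → ℝ)
    (hp0 : ∀ i t, HasDerivAt (p0 i) (p0' i t) t)
    (hq0 : ∀ i t, HasDerivAt (q0 i) (q0' i t) t)
    (C lam : ℝ) (hC : 1 < C) (hlam : 0 < lam)
    (hdecay : ∀ i t, |p0 i t| + latDist (q0 i t) ≤ C * Real.exp (-lam * |t|))
    (hdecay' : ∀ i t, |p0' i t| + |q0' i t| ≤ C * Real.exp (-lam * |t|))
    (H₁ : RPt n d → ℝ) (hH₁ : ContDiff ℝ 2 H₁)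
    (hper_q : ∀ (z : RPt n d) (i : Fin n),
      H₁ (z.1, Function.update z.2.1 i (z.2.1 i + 2 * π), z.2.2) = H₁ z)
    (hper_φ : ∀ (z : RPt n d) (j : Fin d),
      H₁ (z.1, z.2.1, z.2.2.1,
        Function.update z.2.2.2.1 j (z.2.2.2.1 j + 2 * π), z.2.2.2.2) = H₁ z)
    (hper_s : ∀ z : RPt n d,
      H₁ (z.1, z.2.1, z.2.2.1, z.2.2.2.1, z.2.2.2.2 + 2 * π) = H₁ z)
    (ω : (Fin d → ℝ) → Fin d → ℝ)
    (K : Set (Fin n → ℝ)) (hKc : IsCompact K) (hKconv : Convex ℝ K)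
    (hK0 : (0 : Fin n → ℝ) ∈ K) (hKp0 : ∀ t : ℝ, (fun i => p0 i t) ∈ K)
    (I : Fin d → ℝ) (M : ℝ)
    (hM : ∀ p ∈ K, ∀ (q : Fin n → ℝ) (φv : Fin d → ℝ) (s : ℝ),
      (∑ i, (|pd (fun x => H₁ (x, q, I, φv, s)) i p|
        + |pd (fun x => H₁ (p, x, I, φv, s)) i q|)) ≤ M)
    (M₂ : ℝ)
    (hM₂ : ∀ p ∈ K, ∀ (q : Fin n → ℝ) (φv : Fin d → ℝ) (s : ℝ),
      ‖iteratedFDeriv ℝ 2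
          (fun x : (Fin n → ℝ) × (Fin n → ℝ) => H₁ (x.1, x.2, I, φv, s)) (p, q)‖ ≤ M₂) :
    ∀ (φv : Fin d → ℝ) (s : ℝ),
      (⨅ τ : Fin n → ℝ, ∑ i, |pd (fun τ' => Lmel H₁ ω p0 q0 τ' I φv s) i τ|) = 0 := by
  intro φv s
  -- a uniform Lipschitz bound on a compact ball
  set R : ℝ := (C + 1) + ‖I‖ + 2 * π with hR
  have hπ := two_pi_pos
  obtain ⟨A, hA⟩ := (isCompact_closedBall (0 : RPt n d) R).exists_bound_of_continuousOn
    (f := fderiv ℝ H₁) ((hH₁.continuous_fderiv (by norm_num)).continuousOn)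
  have hA0 : 0 ≤ A := (norm_nonneg _).trans (hA 0 (by simp; positivity))
  have hlip : ∀ x ∈ Metric.closedBall (0 : RPt n d) R, ∀ y ∈ Metric.closedBall (0 : RPt n d) R,
      ‖H₁ y - H₁ x‖ ≤ A * ‖y - x‖ := fun x hx y hy =>
    (convex_closedBall (0 : RPt n d) R).norm_image_sub_le_of_norm_fderiv_le
      (fun z _ => (hH₁.differentiable (by norm_num)) z) hA hx hy
  have hpq : ∀ (p q : Fin n → ℝ) (J φ : Fin d → ℝ) (σ : ℝ) (m : Fin n → ℤ),
      H₁ (p, fun i => q i - 2 * π * m i, J, φ, σ) = H₁ (p, q, J, φ, σ) :=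
    fun p q J φ σ m => periodic_lattice (fun x => H₁ (p, x, J, φ, σ))
      (fun x i => hper_q (p, x, J, φ, σ) i) m q
  have hpφ : ∀ (p q : Fin n → ℝ) (J φ : Fin d → ℝ) (σ : ℝ) (m : Fin d → ℤ),
      H₁ (p, q, J, fun i => φ i - 2 * π * m i, σ) = H₁ (p, q, J, φ, σ) :=
    fun p q J φ σ m => periodic_lattice (fun x => H₁ (p, q, J, x, σ))
      (fun x i => hper_φ (p, q, J, x, σ) i) m φ
  have hps : ∀ (p q : Fin n → ℝ) (J φ : Fin d → ℝ) (σ : ℝ) (m : ℤ),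
      H₁ (p, q, J, φ, σ - 2 * π * m) = H₁ (p, q, J, φ, σ) := by
    intro p q J φ σ m
    have hP : Function.Periodic (fun x => H₁ (p, q, J, φ, x)) (2 * π) :=
      fun x => hper_s (p, q, J, φ, x)
    have := hP.sub_zsmul_eq (x := σ) m
    simpa [mul_comm] using this
  -- pointwise bound of the integrand
  have hbound : ∀ (τ : Fin n → ℝ) (t : ℝ), ‖melInt H₁ ω p0 q0 τ I φv s t‖ ≤
      A * ∑ i, (C + 1) * Real.exp (-lam * |τ i + t|) := by
    intro τ t
    set E : ℝ := ∑ i, (C + 1) * Real.exp (-lam * |τ i + t|) with hE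
    have hE0 : 0 ≤ E := by
      apply Finset.sum_nonneg; intro i _; positivity
    have hEi : ∀ i, (C + 1) * Real.exp (-lam * |τ i + t|) ≤ E := fun i =>
      Finset.single_le_sum (f := fun i => (C + 1) * Real.exp (-lam * |τ i + t|))
        (fun i _ => by positivity) (Finset.mem_univ i)
    have hexp : ∀ i, Real.exp (-lam * |τ i + t|) ≤ 1 := fun i => by
      rw [Real.exp_le_one_iff]
      nlinarith [abs_nonneg (τ i + t)]
    have hlat0 : ∀ x, 0 ≤ latDist x := fun x => Metric.infDist_nonneg
    have hq : ∀ i, ∃ m : ℤ, |q0 i (τ i + t) - 2 * π * m|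
        < (C + 1) * Real.exp (-lam * |τ i + t|) := fun i => by
      apply lattice_approx
      have := hdecay i (τ i + t)
      have := abs_nonneg (p0 i (τ i + t))
      have := Real.exp_pos (-lam * |τ i + t|)
      linarith
    choose m hm using hq
    have hp : ∀ i, |p0 i (τ i + t)| ≤ (C + 1) * Real.exp (-lam * |τ i + t|) := fun i => by
      have := hdecay i (τ i + t)
      have := hlat0 (q0 i (τ i + t))
      have := Real.exp_pos (-lam * |τ i + t|)
      linarith
    have hC1 : ∀ i, (C + 1) * Real.exp (-lam * |τ i + t|) ≤ C + 1 := fun i => by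
      nlinarith [hexp i]
    choose k hk using fun j => lattice_reduce (φv j + ω I j * t)
    obtain ⟨l, hl⟩ := lattice_reduce (s + t)
    unfold melInt
    rw [← hpq _ _ _ _ _ m, ← hpφ _ _ _ _ _ k, ← hps _ _ _ _ _ l,
      ← hpφ 0 0 I _ _ k, ← hps 0 0 I _ _ l]
    have hI0 := norm_nonneg I
    have b1 : ‖(fun i => p0 i (τ i + t) : Fin n → ℝ)‖ ≤ R := by
      rw [pi_norm_le_iff_of_nonneg (by positivity)]
      intro i; have := hp i; have := hC1 i; rw [Real.norm_eq_abs]; linarith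
    have b2 : ‖(fun i => q0 i (τ i + t) - 2 * π * m i : Fin n → ℝ)‖ ≤ R := by
      rw [pi_norm_le_iff_of_nonneg (by positivity)]
      intro i; have := hm i; have := hC1 i; rw [Real.norm_eq_abs]; linarith
    have b3 : ‖I‖ ≤ R := by linarith
    have b4 : ‖(fun j => φv j + ω I j * t - 2 * π * k j : Fin d → ℝ)‖ ≤ R := by
      rw [pi_norm_le_iff_of_nonneg (by positivity)]
      intro i; have := hk i; rw [Real.norm_eq_abs]; linarith
    have b5 : ‖s + t - 2 * π * l‖ ≤ R := by
      rw [Real.norm_eq_abs]; linarith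
    have hR0 : 0 ≤ R := by positivity
    refine (hlip _ ?_ _ ?_).trans ?_
    · rw [mem_closedBall_zero_iff]
      simp only [Prod.norm_mk, sup_le_iff, norm_zero]
      exact ⟨hR0, hR0, b3, b4, b5⟩
    · rw [mem_closedBall_zero_iff]
      simp only [Prod.norm_mk, sup_le_iff]
      exact ⟨b1, b2, b3, b4, b5⟩
    · apply mul_le_mul_of_nonneg_left _ hA0
      simp only [Prod.mk_sub_mk, Prod.norm_mk, sup_le_iff, sub_self, norm_zero, sub_zero]
      refine ⟨?_, ?_, hE0⟩
      · rw [pi_norm_le_iff_of_nonneg hE0]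
        intro i; rw [Real.norm_eq_abs]; exact (hp i).trans (hEi i)
      · rw [pi_norm_le_iff_of_nonneg hE0]
        intro i; rw [Real.norm_eq_abs]; exact (hm i).le.trans (hEi i)
  have hint1 : ∀ a : ℝ, Integrable (fun t : ℝ => (C + 1) * Real.exp (-lam * |a + t|)) := fun a =>
    ((integrable_expabs hlam).comp_add_left a).const_mul _
  have hint : ∀ τ : Fin n → ℝ,
      Integrable (fun t : ℝ => A * ∑ i, (C + 1) * Real.exp (-lam * |τ i + t|)) := fun τ =>
    (integrable_finsetSum _ fun i _ => hint1 (τ i)).const_mul _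
  have hp0c : ∀ i, Continuous (p0 i) := fun i =>
    continuous_iff_continuousAt.2 fun t => (hp0 i t).continuousAt
  have hq0c : ∀ i, Continuous (q0 i) := fun i =>
    continuous_iff_continuousAt.2 fun t => (hq0 i t).continuousAt
  have hHc : Continuous H₁ := hH₁.continuous
  have hcont : Continuous (fun τ' => Lmel H₁ ω p0 q0 τ' I φv s) := by
    unfold Lmel
    refine Continuous.neg (continuous_iff_continuousAt.2 fun τ₀ => ?_)
    refine continuousAt_of_dominated
      (bound := fun t => Real.exp lam * (A * ∑ i, (C + 1) * Real.exp (-lam * |τ₀ i + t|)))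
      ?_ ?_ ((hint τ₀).const_mul _) ?_
    · refine Filter.Eventually.of_forall fun τ => Continuous.aestronglyMeasurable ?_
      unfold melInt
      fun_prop
    · filter_upwards [Metric.closedBall_mem_nhds τ₀ one_pos] with τ hτ
      refine Filter.Eventually.of_forall fun t => (hbound τ t).trans ?_
      rw [mul_left_comm]
      apply mul_le_mul_of_nonneg_left _ hA0
      rw [Finset.mul_sum]
      apply Finset.sum_le_sum
      intro i _
      rw [mul_left_comm]
      apply mul_le_mul_of_nonneg_left _ (by linarith)
      rw [← Real.exp_add, Real.exp_le_exp]
      have h1 : |τ i - τ₀ i| ≤ 1 := (dist_le_pi_dist τ τ₀ i).trans hτ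
      have h2 : |τ₀ i + t| ≤ |τ i + t| + 1 := by
        have := abs_sub_abs_le_abs_sub (τ₀ i + t) (τ i + t)
        rw [abs_sub_comm] at h1
        have e : τ₀ i + t - (τ i + t) = τ₀ i - τ i := by ring
        rw [e] at this
        linarith
      nlinarith
    · refine Filter.Eventually.of_forall fun t => Continuous.continuousAt ?_
      unfold melInt
      fun_prop
  refine iInf_grad_eq_zero _ hcont (A * ∑ _i : Fin n, ∫ t : ℝ, (C + 1) * Real.exp (-lam * |t|)) ?_
  intro τ
  unfold Lmel
  rw [abs_neg]
  refine (norm_integral_le_of_norm_le (hint τ)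
    (Filter.Eventually.of_forall (hbound τ))).trans (le_of_eq ?_)
  rw [integral_const_mul, integral_finsetSum _ (fun i _ => hint1 (τ i))]
  congr 1
  apply Finset.sum_congr rfl
  intro i _
  exact integral_add_left_eq_self (fun t => (C + 1) * Real.exp (-lam * |t|)) (τ i)
end
end
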